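/- arXiv:0901.2453 — 2 statements merged into one kernel-verified Lean document; each statement's English description precedes it below -/
import Mathlib

section
/- Assume there exist measurable functions W : X → [1,∞) and n : X → {1,2,…}, constants β ∈ (0,1) and b < ∞, and a measurable set C such that P^{n(x)} W(x) ≤ β W(x) + b·1_C(x) for all x ∈ X. Suppose there is a strictly increasing function R : (0,∞) → (0,∞) such that t ↦ R(t)/t is non-increasing and R(n(x)) ≤ W(x) for all x. Then there exists a constant C' < ∞ such that 𝔼_x[R(τ_C)] ≤ C'·(W(x) + b·1_C(x)) for all x ∈ X. -/
open MeasureTheory ProbabilityTheory ENNReal Set Filter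

variable {X : Type*} [MeasurableSpace X]

/-- The `n`-step transition kernel `P^n`. -/
noncomputable def kernelIter (P : Kernel X X) : ℕ → Kernel X X
  | 0 => Kernel.id
  | n + 1 => (kernelIter P n) ∘ₖ P

instance kernelIter.instIsMarkovKernel (P : Kernel X X) [IsMarkovKernel P] (n : ℕ) :
    IsMarkovKernel (kernelIter P n) := by
  induction n with
  | zero => rw [kernelIter]; infer_instance
  | succ n ih => rw [kernelIter]; exact Kernel.IsMarkovKernel.comp _ _

/-- `P^n f (x) = ∫ P^n(x, dy) f(y)` for a nonnegative (real-valued) function `f`. -/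
noncomputable def kernelExp (μ : Measure X) (f : X → ℝ) : ℝ≥0∞ :=
  ∫⁻ y, ENNReal.ofReal (f y) ∂μ

/-- The `f`-norm `‖μ - ν‖_f = ∫ f d|μ - ν|` of the difference of two finite measures. -/
noncomputable def fNorm (μ ν : Measure X) [IsFiniteMeasure μ] [IsFiniteMeasure ν]
    (f : X → ℝ) : ℝ≥0∞ :=
  ∫⁻ x, ENNReal.ofReal (f x) ∂((μ.toSignedMeasure - ν.toSignedMeasure).totalVariation)

/-- `retTaboo P C f n x = 𝔼ₓ[f(Φₙ) 1_{Φ₁ ∉ C, …, Φₙ ∉ C}] = 𝔼ₓ[f(Φₙ) 1_{τ_C > n}]`,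
where `τ_C` is the first return time to `C`. -/
noncomputable def retTaboo (P : Kernel X X) (C : Set X) (f : X → ℝ≥0∞) : ℕ → X → ℝ≥0∞
  | 0 => f
  | n + 1 => fun x => ∫⁻ y, Cᶜ.indicator (retTaboo P C f n) y ∂(P x)

/-- `survival P C n x = ℙₓ(τ_C > n)` where `τ_C := inf {n ≥ 1 : Φₙ ∈ C}`. -/
noncomputable def survival (P : Kernel X X) (C : Set X) (n : ℕ) (x : X) : ℝ≥0∞ :=
  retTaboo P C (fun _ => 1) n x

/-- `𝔼ₓ[R(τ_C)]` for `R : ℕ → ℝ≥0∞`, where `τ_C := inf {n ≥ 1 : Φₙ ∈ C}` is the first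
return time to `C`, with the convention `R(∞) = lim_n R(n) = ⨆ n, R(n+1)`
(the event `{τ_C = ∞}` has probability `⨅ n, ℙₓ(τ_C > n)`). -/
noncomputable def expReturn (P : Kernel X X) (C : Set X) (R : ℕ → ℝ≥0∞) (x : X) : ℝ≥0∞ :=
  (∑' n, R (n + 1) * (survival P C n x - survival P C (n + 1) x))
    + (⨆ n, R (n + 1)) * ⨅ n, survival P C n x

/-- `hitTaboo P C f n x = 𝔼ₓ[f(Φₙ) 1_{Φ₀ ∉ C, …, Φ_{n-1} ∉ C}] = 𝔼ₓ[f(Φₙ) 1_{σ_C ≥ n}]`,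
where `σ_C := inf {n ≥ 0 : Φₙ ∈ C}` is the hitting time of `C`. -/
noncomputable def hitTaboo (P : Kernel X X) (C : Set X) (f : X → ℝ≥0∞) : ℕ → X → ℝ≥0∞
  | 0 => f
  | n + 1 => fun x => Cᶜ.indicator (fun x' => ∫⁻ y, hitTaboo P C f n y ∂(P x')) x

/-- `hitSurvival P C n x = ℙₓ(σ_C ≥ n)` where `σ_C := inf {n ≥ 0 : Φₙ ∈ C}`. -/
noncomputable def hitSurvival (P : Kernel X X) (C : Set X) (n : ℕ) (x : X) : ℝ≥0∞ :=
  hitTaboo P C (fun _ => 1) n x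

/-- A set `C` is small for the kernel `P`: `P(x, ·) ≥ ε ν(·)` for all `x ∈ C`,
for some `ε > 0` and nontrivial measure `ν`. -/
def IsSmallSet (P : Kernel X X) (C : Set X) : Prop :=
  ∃ (ε : ℝ) (ν : Measure X), 0 < ε ∧ ν ≠ 0 ∧
    ∀ x ∈ C, ∀ A : Set X, MeasurableSet A → ENNReal.ofReal ε * ν A ≤ P x A

/-- `P` is phi-irreducible. -/
def KIrreducible (P : Kernel X X) : Prop :=
  ∃ φ : Measure X, φ ≠ 0 ∧ SigmaFinite φ ∧
    ∀ A : Set X, MeasurableSet A → 0 < φ A → ∀ x : X, ∃ n, 1 ≤ n ∧ 0 < kernelIter P n x A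

/-- `P` is aperiodic: there is a small set `C₀` with small-set measure `ν`, `ν C₀ > 0`, such
that the set `{n ≥ 1 : ∃ δ > 0, ∀ x ∈ C₀, P^n(x,·) ≥ δ ν(·)}` has gcd `1` (i.e. every common
divisor of this set equals `1`). -/
def KAperiodic (P : Kernel X X) : Prop :=
  ∃ (C₀ : Set X) (ν : Measure X) (ε : ℝ), MeasurableSet C₀ ∧ 0 < ε ∧ ν ≠ 0 ∧
    (∀ x ∈ C₀, ∀ A : Set X, MeasurableSet A → ENNReal.ofReal ε * ν A ≤ P x A) ∧
    0 < ν C₀ ∧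
    ∀ d : ℕ,
      (∀ n, 1 ≤ n →
        (∃ δ : ℝ, 0 < δ ∧ ∀ x ∈ C₀, ∀ A : Set X, MeasurableSet A →
            ENNReal.ofReal δ * ν A ≤ kernelIter P n x A) → d ∣ n) → d = 1

/-- A set `D` is accessible for `P`. -/
def Accessible (P : Kernel X X) (D : Set X) : Prop :=
  ∀ x : X, ∃ n, 1 ≤ n ∧ 0 < kernelIter P n x D

/-- The class `Λ` of subgeometric rate sequences. -/
def SubgeometricRate (r : ℕ → ℝ) : Prop :=
  (∀ n, 0 ≤ r n) ∧ Monotone r ∧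
    ∃ r₀ : ℕ → ℝ, 1 ≤ r₀ 0 ∧ Monotone r₀ ∧
      (∀ m n : ℕ, 1 ≤ m → m ≤ n → Real.log (r₀ n) / n ≤ Real.log (r₀ m) / m) ∧
      Tendsto (fun n => Real.log (r₀ n) / n) atTop (nhds 0) ∧
      Tendsto (fun n => r n / r₀ n) atTop (nhds 1)

/-- After at least one step the taboo expectation only depends on the values of `f` off `C`. -/
lemma retTaboo_mono_of_le_compl (P : Kernel X X) (C : Set X) {f g : X → ℝ≥0∞}
    (hfg : ∀ y ∉ C, f y ≤ g y) {m : ℕ} (hm : 1 ≤ m) (x : X) :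
    retTaboo P C f m x ≤ retTaboo P C g m x := by
  induction m, hm using Nat.le_induction generalizing x with
  | base =>
    refine lintegral_mono fun y => ?_
    by_cases hy : y ∈ C
    · simp [hy]
    · simpa [hy, retTaboo] using hfg y hy
  | succ m _ ih => exact lintegral_mono fun y => Set.indicator_le_indicator (ih y)

lemma retTaboo_le_lintegral_kernelIter (P : Kernel X X) (C : Set X) {f : X → ℝ≥0∞}
    (hf : Measurable f) (m : ℕ) (x : X) :
    retTaboo P C f m x ≤ ∫⁻ y, f y ∂(kernelIter P m x) := by
  induction m generalizing x with
  | zero => simp [retTaboo, kernelIter, Kernel.id_apply, lintegral_dirac' x hf]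
  | succ m ih =>
    rw [kernelIter, Kernel.lintegral_comp _ _ _ hf]
    exact lintegral_mono fun y => (Set.indicator_le_self' (by simp) y).trans (ih y)

lemma measurable_retTaboo (P : Kernel X X) {C : Set X} (hC : MeasurableSet C)
    {f : X → ℝ≥0∞} (hf : Measurable f) (m : ℕ) : Measurable (retTaboo P C f m) := by
  induction m with
  | zero => exact hf
  | succ m ih => exact (ih.indicator hC.compl).lintegral_kernel

lemma retTaboo_sum_mul (P : Kernel X X) {C : Set X} (hC : MeasurableSet C) {ι : Type*}
    (s : Finset ι) (a : ι → ℝ≥0∞) {f : ι → X → ℝ≥0∞} (hf : ∀ i, Measurable (f i))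
    (m : ℕ) (x : X) :
    retTaboo P C (fun y => ∑ i ∈ s, a i * f i y) m x
      = ∑ i ∈ s, a i * retTaboo P C (f i) m x := by
  induction m generalizing x with
  | zero => rfl
  | succ m ih =>
    have hmeas i := (measurable_retTaboo P hC (hf i) m).indicator hC.compl
    simp only [retTaboo]
    simp_rw [← fun i => lintegral_const_mul (μ := P x) (a i) (hmeas i)]
    rw [← lintegral_finsetSum _ fun i _ => (hmeas i).const_mul (a i)]
    refine lintegral_congr fun y => ?_
    by_cases hy : y ∈ C
    · simp [hy]
    · simp [hy, ih]

/-- The Markov property at a deterministic time. -/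
lemma retTaboo_survival (P : Kernel X X) (C : Set X) (m j : ℕ) (x : X) :
    retTaboo P C (survival P C j) m x = survival P C (m + j) x := by
  induction m generalizing x with
  | zero => simp [retTaboo]
  | succ m ih =>
    rw [Nat.add_right_comm]
    simp only [survival, retTaboo] at ih ⊢
    exact lintegral_congr fun y => congrArg (fun g => Cᶜ.indicator g y) (funext ih)

lemma survival_succ_le (P : Kernel X X) [IsMarkovKernel P] (C : Set X) (j : ℕ) (x : X) :
    survival P C (j + 1) x ≤ survival P C j x := by
  induction j generalizing x with
  | zero =>
    calc survival P C 1 x ≤ ∫⁻ _, 1 ∂(P x) :=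
          lintegral_mono fun y => Set.indicator_le_self' (by simp) y
      _ = survival P C 0 x := by simp [survival, retTaboo]
  | succ j ih => exact lintegral_mono fun y => Set.indicator_le_indicator (ih y)

lemma survival_le_one (P : Kernel X X) [IsMarkovKernel P] (C : Set X) (j : ℕ) (x : X) :
    survival P C j x ≤ 1 :=
  (antitone_nat_of_succ_le (f := fun j => survival P C j x)
    fun j => survival_succ_le P C j x) (Nat.zero_le j)

lemma sum_range_tsub_add {r : ℕ → ℝ≥0∞} (hr : Monotone r) (k m : ℕ) :
    ∑ j ∈ Finset.range m, (r (k + j + 1) - r (k + j)) + r k = r (k + m) := by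
  induction m with
  | zero => simp
  | succ m ih =>
    rw [Finset.sum_range_succ, add_right_comm, ih, ← add_assoc,
      add_tsub_cancel_of_le (hr (Nat.le_succ _))]

/-- State-dependent drift bounds the increments `𝔼ₓ[r (k + τ_C ∧ N)] - r k`, written by summation
by parts, for a subadditive rate `r`. -/
lemma sum_tsub_mul_survival_le (P : Kernel X X) [IsMarkovKernel P]
    {C : Set X} (hC : MeasurableSet C) {r : ℕ → ℝ≥0∞} (hr : Monotone r)
    (hr_top : ∀ k, r k ≠ ∞) (hr_add : ∀ k m, r (k + m) ≤ r k + r m)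
    {U B : X → ℝ≥0∞} (hU : Measurable U) (hB : ∀ y ∉ C, B y = 0)
    {n : X → ℕ} (hn : ∀ x, 1 ≤ n x)
    (hdrift : ∀ x, r (n x) + ∫⁻ y, U y ∂(kernelIter P (n x) x) ≤ U x + B x)
    (N k : ℕ) (x : X) :
    ∑ j ∈ Finset.range N, (r (k + j + 1) - r (k + j)) * survival P C j x ≤ U x + B x := by
  induction N using Nat.strong_induction_on generalizing k x with
  | _ N ih =>
    have hhead (m : ℕ) :
        ∑ j ∈ Finset.range m, (r (k + j + 1) - r (k + j)) * survival P C j x ≤ r m := by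
      calc ∑ j ∈ Finset.range m, (r (k + j + 1) - r (k + j)) * survival P C j x
          ≤ ∑ j ∈ Finset.range m, (r (k + j + 1) - r (k + j)) :=
            Finset.sum_le_sum fun j _ => mul_le_of_le_one_right' (survival_le_one P C j x)
        _ ≤ r m := by
            refine (ENNReal.add_le_add_iff_right (hr_top k)).1 ?_
            rw [sum_range_tsub_add hr, add_comm (r m)]
            exact hr_add k m
    rcases le_total N (n x) with hN | hN
    · exact (hhead N).trans ((hr hN).trans (le_self_add.trans (hdrift x)))
    · obtain ⟨M, rfl⟩ := Nat.exists_eq_add_of_le hN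
      have hM : M < n x + M := by have := hn x; omega
      rw [Finset.sum_range_add]
      refine (add_le_add (hhead (n x)) ?_).trans (hdrift x)
      calc ∑ j ∈ Finset.range M,
            (r (k + (n x + j) + 1) - r (k + (n x + j))) * survival P C (n x + j) x
          = retTaboo P C (fun y => ∑ j ∈ Finset.range M,
              (r (k + n x + j + 1) - r (k + n x + j)) * survival P C j y) (n x) x := by
            rw [retTaboo_sum_mul P hC _ _ (f := survival P C)
              fun j => measurable_retTaboo P hC measurable_const j]
            simp_rw [retTaboo_survival, add_assoc]
        _ ≤ retTaboo P C U (n x) x :=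
            retTaboo_mono_of_le_compl P C
              (fun y hy => by simpa [hB y hy] using ih M hM (k + n x) y) (hn x) x
        _ ≤ _ := retTaboo_le_lintegral_kernelIter P C hU _ _

lemma sum_mul_survival_sub_add (P : Kernel X X) [IsMarkovKernel P] (C : Set X)
    {r : ℕ → ℝ≥0∞} (hr : Monotone r) (hr_zero : r 0 = 0) (N : ℕ) (x : X) :
    ∑ j ∈ Finset.range N, r (j + 1) * (survival P C j x - survival P C (j + 1) x)
        + r N * survival P C N x
      = ∑ j ∈ Finset.range N, (r (j + 1) - r j) * survival P C j x := by
  induction N with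
  | zero => simp [hr_zero]
  | succ N ih =>
    rw [Finset.sum_range_succ, Finset.sum_range_succ, ← ih, add_assoc, add_assoc, ← mul_add,
      ← add_mul, tsub_add_cancel_of_le (survival_succ_le P C N x),
      add_tsub_cancel_of_le (hr N.le_succ)]

lemma expReturn_le_of_sum_le (P : Kernel X X) [IsMarkovKernel P] (C : Set X)
    {r : ℕ → ℝ≥0∞} (hr : Monotone r) (hr_zero : r 0 = 0) {x : X} {K : ℝ≥0∞}
    (hK : ∀ N, ∑ j ∈ Finset.range N, (r (j + 1) - r j) * survival P C j x ≤ K) :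
    expReturn P C r x ≤ K := by
  rw [expReturn, ENNReal.tsum_eq_iSup_nat, ENNReal.iSup_mul,
    ENNReal.iSup_add_iSup_of_monotone]
  · refine iSup_le fun N => le_trans ?_ (hK (N + 1))
    rw [← sum_mul_survival_sub_add P C hr hr_zero]
    gcongr
    · exact N.le_succ
    · exact iInf_le _ _
  · exact fun a b h => Finset.sum_le_sum_of_subset (Finset.range_mono h)
  · intro a b h
    dsimp only
    gcongr
    exact hr (by omega)

lemma add_le_of_antitone_div {R : ℝ → ℝ}
    (hR : ∀ s t : ℝ, 0 < s → s ≤ t → R t / t ≤ R s / s) {s t : ℝ} (hs : 0 < s) (ht : 0 < t) :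
    R (s + t) ≤ R s + R t := by
  have h₁ := hR s (s + t) hs (by linarith)
  have h₂ := hR t (s + t) ht (by linarith)
  rw [le_div_iff₀ hs] at h₁
  rw [le_div_iff₀ ht] at h₂
  calc R (s + t) = R (s + t) / (s + t) * s + R (s + t) / (s + t) * t := by
        field_simp
    _ ≤ R s + R t := add_le_add h₁ h₂

/-- Theorem `subsampled2moments`, case (i).  From the state-dependent drift
condition `P^{n(x)} W (x) ≤ β W(x) + b 1_C(x)` and a strictly increasing `R` with `R(t)/t`
non-increasing and `R ∘ n ≤ W`, one gets `𝔼ₓ[R(τ_C)] ≤ C' (W(x) + b 1_C(x))`. -/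
theorem statement7
    (P : Kernel X X) [IsMarkovKernel P]
    (W : X → ℝ) (hWmeas : Measurable W) (hW1 : ∀ x, 1 ≤ W x)
    (n : X → ℕ) (hnmeas : Measurable n) (hn1 : ∀ x, 1 ≤ n x)
    (β : ℝ) (hβ : β ∈ Set.Ioo (0 : ℝ) 1) (b : ℝ) (hb : 0 ≤ b)
    (C : Set X) (hCmeas : MeasurableSet C)
    (hdrift : ∀ x, kernelExp ((kernelIter P (n x)) x) W
        ≤ ENNReal.ofReal (β * W x + b * Set.indicator C (fun _ => 1) x))
    (R : ℝ → ℝ) (hRmono : StrictMonoOn R (Set.Ioi 0))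
    (hRpos : ∀ t : ℝ, 0 < t → 0 < R t)
    (hRsub : ∀ s t : ℝ, 0 < s → s ≤ t → R t / t ≤ R s / s)
    (hRn : ∀ x, R (n x) ≤ W x) :
    ∃ C' : ℝ, 0 ≤ C' ∧ ∀ x,
      expReturn P C (fun k : ℕ => ENNReal.ofReal (R k)) x
        ≤ ENNReal.ofReal (C' * (W x + b * Set.indicator C (fun _ => 1) x)) := by
  obtain ⟨hβ0, hβ1⟩ := hβ
  have hc : 0 < (1 - β)⁻¹ := inv_pos.2 (by linarith)
  have hcβ : 1 + (1 - β)⁻¹ * β = (1 - β)⁻¹ := by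
    have : 1 - β ≠ 0 := by linarith
    field_simp
    ring
  set c := (1 - β)⁻¹
  have hpos (x : X) : 0 ≤ b * Set.indicator C (fun _ => (1 : ℝ)) x :=
    mul_nonneg hb (Set.indicator_nonneg (fun _ _ => zero_le_one) x)
  have hW0 (x : X) : 0 ≤ W x := zero_le_one.trans (hW1 x)
  let r : ℕ → ℝ≥0∞ := fun k => if k = 0 then 0 else ENNReal.ofReal (R k)
  have hr_succ (k : ℕ) (hk : 1 ≤ k) : r k = ENNReal.ofReal (R k) := if_neg (by omega)
  have hr : Monotone r := by
    intro k m hkm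
    rcases Nat.eq_zero_or_pos k with rfl | hk
    · simp [r]
    · rw [hr_succ k hk, hr_succ m (hk.trans_le hkm)]
      exact ENNReal.ofReal_le_ofReal (hRmono.monotoneOn (Set.mem_Ioi.2 (by exact_mod_cast hk))
        (Set.mem_Ioi.2 (by exact_mod_cast hk.trans_le hkm)) (by exact_mod_cast hkm))
  have hr_top (k : ℕ) : r k ≠ ∞ := by
    by_cases hk : k = 0 <;> simp [r, hk]
  have hr_add (k m : ℕ) : r (k + m) ≤ r k + r m := by
    rcases Nat.eq_zero_or_pos k with rfl | hk
    · simp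
    rcases Nat.eq_zero_or_pos m with rfl | hm
    · simp
    have hk' : (0 : ℝ) < k := by exact_mod_cast hk
    have hm' : (0 : ℝ) < m := by exact_mod_cast hm
    rw [hr_succ k hk, hr_succ m hm, hr_succ (k + m) (by omega), Nat.cast_add,
      ← ENNReal.ofReal_add (hRpos _ hk').le (hRpos _ hm').le]
    exact ENNReal.ofReal_le_ofReal (add_le_of_antitone_div hRsub hk' hm')
  refine ⟨c, hc.le, fun x => ?_⟩
  have hexp : expReturn P C (fun k : ℕ => ENNReal.ofReal (R k)) x = expReturn P C r x := by
    simp [expReturn, r]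
  rw [hexp, mul_add, ENNReal.ofReal_add (mul_nonneg hc.le (hW0 x)) (mul_nonneg hc.le (hpos x))]
  refine expReturn_le_of_sum_le P C hr (if_pos rfl) fun N => ?_
  have key := sum_tsub_mul_survival_le P hCmeas hr hr_top hr_add
    (U := fun y => ENNReal.ofReal (c * W y))
    (B := fun y => ENNReal.ofReal (c * (b * Set.indicator C (fun _ => (1 : ℝ)) y)))
    (by fun_prop) (fun y hy => by simp [hy]) hn1 (fun y => ?_) N 0 x
  · simpa using key
  · have hd := hdrift y
    rw [kernelExp] at hd
    simp_rw [ENNReal.ofReal_mul hc.le]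
    rw [lintegral_const_mul _ (by fun_prop), hr_succ _ (hn1 y)]
    calc ENNReal.ofReal (R (n y))
          + ENNReal.ofReal c * ∫⁻ z, ENNReal.ofReal (W z) ∂(kernelIter P (n y) y)
        ≤ ENNReal.ofReal (W y) + ENNReal.ofReal c
          * ENNReal.ofReal (β * W y + b * Set.indicator C (fun _ => 1) y) := by
          gcongr
          exact hRn y
      _ = _ := by
          rw [← ENNReal.ofReal_mul hc.le, ← ENNReal.ofReal_mul hc.le, ← ENNReal.ofReal_mul hc.le,
            ← ENNReal.ofReal_add (hW0 y)
              (mul_nonneg hc.le (add_nonneg (mul_nonneg hβ0.le (hW0 y)) (hpos y))),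
            ← ENNReal.ofReal_add (mul_nonneg hc.le (hW0 y)) (mul_nonneg hc.le (hpos y))]
          congr 1
          linear_combination W y * hcβ
end

section
/- Assume there exist measurable functions W : X → [1,∞) and n : X → {1,2,…}, constants β ∈ (0,1) and b < ∞, and a measurable set C such that P^{n(x)} W(x) ≤ β W(x) + b·1_C(x) for all x ∈ X. Suppose there is a strictly increasing, convex, continuously differentiable bijection R of (0,∞) onto (0,∞) whose derivative R' is log-concave, such that R⁻¹(W(x)) − R⁻¹(β W(x)) ≥ n(x) for all x. Then there exists a constant C' < ∞ such that 𝔼_x[R(τ_C)] ≤ C'·(W(x) + b·1_C(x)) for all x ∈ X. -/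
open MeasureTheory ProbabilityTheory ENNReal Set Filter

variable {X : Type*} [MeasurableSpace X]

/-- The expectation `𝔼ₓ[f(t + min(σ_C, N))]`, where `σ_C := inf {n ≥ 0 : Φₙ ∈ C}`. -/
noncomputable def hitTrunc (P : Kernel X X) (C : Set X) (f : ℕ → ℝ≥0∞) : ℕ → ℕ → X → ℝ≥0∞
  | 0, t => fun _ => f t
  | N + 1, t => fun x =>
      C.indicator (fun _ => f t) x
        + Cᶜ.indicator (fun x' => ∫⁻ y, hitTrunc P C f N (t + 1) y ∂(P x')) x

/-- The expectation `𝔼ₓ[f(t + min(τ_C, N))]`, written in terms of the survival function. -/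
noncomputable def retTrunc (P : Kernel X X) (C : Set X) (f : ℕ → ℝ≥0∞) (N t : ℕ) (x : X) : ℝ≥0∞ :=
  (∑ k ∈ Finset.range N, f (t + k + 1) * (survival P C k x - survival P C (k + 1) x))
    + f (t + N) * survival P C N x

section Markov

variable (P : Kernel X X) {C : Set X} {f : ℕ → ℝ≥0∞}

lemma measurable_survival (hC : MeasurableSet C) (k : ℕ) : Measurable (survival P C k) := by
  induction k with
  | zero => exact measurable_const
  | succ k ih => exact (ih.indicator hC.compl).lintegral_kernel

lemma measurable_hitTrunc (hC : MeasurableSet C) (N t : ℕ) : Measurable (hitTrunc P C f N t) := by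
  induction N generalizing t with
  | zero => exact measurable_const
  | succ N ih =>
    exact (measurable_const.indicator hC).add ((ih (t + 1)).lintegral_kernel.indicator hC.compl)

lemma hitTrunc_of_mem (N t : ℕ) {x : X} (hx : x ∈ C) : hitTrunc P C f N t x = f t := by
  cases N <;> simp [hitTrunc, hx]

lemma hitTrunc_succ_of_notMem (N t : ℕ) {x : X} (hx : x ∉ C) :
    hitTrunc P C f (N + 1) t x = ∫⁻ y, hitTrunc P C f N (t + 1) y ∂(P x) := by
  simp [hitTrunc, hx]

lemma survival_succ (k : ℕ) (x : X) :
    survival P C (k + 1) x = ∫⁻ y, Cᶜ.indicator (survival P C k) y ∂(P x) := rfl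

lemma lintegral_kernelIter_succ (m : ℕ) {g : X → ℝ≥0∞} (hg : Measurable g) (x : X) :
    ∫⁻ y, g y ∂(kernelIter P (m + 1) x) = ∫⁻ y, ∫⁻ z, g z ∂(kernelIter P m y) ∂(P x) :=
  Kernel.lintegral_comp _ _ _ hg

lemma survival_succ_sub_le (hC : MeasurableSet C) (k : ℕ) (x : X) :
    survival P C (k + 1) x - survival P C (k + 2) x
      ≤ ∫⁻ y, Cᶜ.indicator (fun y => survival P C k y - survival P C (k + 1) y) y ∂(P x) := by
  rw [survival_succ, survival_succ]
  refine (lintegral_sub_le _ _ ((measurable_survival P hC (k + 1)).indicator hC.compl)).trans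
    (lintegral_mono fun y => ?_)
  by_cases hy : y ∈ C <;> simp [hy]

variable [IsMarkovKernel P]

lemma survival_zero_sub_le (hC : MeasurableSet C) (x : X) :
    survival P C 0 x - survival P C 1 x ≤ ∫⁻ y, C.indicator 1 y ∂(P x) := by
  have h0 : survival P C 0 x = ∫⁻ _, 1 ∂(P x) := by simp [survival, retTaboo]
  rw [h0, survival_succ]
  refine (lintegral_sub_le _ _ ((measurable_survival P hC 0).indicator hC.compl)).trans
    (lintegral_mono fun y => ?_)
  by_cases hy : y ∈ C <;> simp [hy, survival, retTaboo]

lemma retTrunc_succ_le (hC : MeasurableSet C) (N t : ℕ) (x : X) :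
    retTrunc P C f (N + 1) t x
      ≤ ∫⁻ y, C.indicator (fun _ => f (t + 1)) y
          + Cᶜ.indicator (retTrunc P C f N (t + 1)) y ∂(P x) := by
  have hq (k : ℕ) : Measurable
      (Cᶜ.indicator (fun y => survival P C k y - survival P C (k + 1) y)) :=
    ((measurable_survival P hC k).sub (measurable_survival P hC (k + 1))).indicator hC.compl
  have hS : Measurable (Cᶜ.indicator (survival P C N)) :=
    (measurable_survival P hC N).indicator hC.compl
  have h1 : Measurable (C.indicator (1 : X → ℝ≥0∞)) := measurable_one.indicator hC
  calc retTrunc P C f (N + 1) t x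
      = (∑ k ∈ Finset.range N, f (t + 1 + k + 1)
            * (survival P C (k + 1) x - survival P C (k + 2) x))
          + f (t + 1) * (survival P C 0 x - survival P C 1 x)
          + f (t + 1 + N) * survival P C (N + 1) x := by
        rw [retTrunc, Finset.sum_range_succ']
        simp only [add_zero, zero_add]
        congr 2
        · refine Finset.sum_congr rfl fun k _ => ?_
          rw [show t + (k + 1) + 1 = t + 1 + k + 1 by ring]
        · rw [show t + (N + 1) = t + 1 + N by ring]
    _ ≤ (∑ k ∈ Finset.range N, f (t + 1 + k + 1)
            * ∫⁻ y, Cᶜ.indicator (fun y => survival P C k y - survival P C (k + 1) y) y ∂(P x))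
          + f (t + 1) * (∫⁻ y, C.indicator 1 y ∂(P x))
          + f (t + 1 + N) * ∫⁻ y, Cᶜ.indicator (survival P C N) y ∂(P x) := by
        gcongr with k
        · exact survival_succ_sub_le P hC k x
        · exact survival_zero_sub_le P hC x
        · rfl
    _ = ∫⁻ y, (∑ k ∈ Finset.range N, f (t + 1 + k + 1)
            * Cᶜ.indicator (fun y => survival P C k y - survival P C (k + 1) y) y)
          + f (t + 1) * C.indicator 1 y
          + f (t + 1 + N) * Cᶜ.indicator (survival P C N) y ∂(P x) := by
        rw [lintegral_add_right _ (hS.const_mul _), lintegral_add_right _ (h1.const_mul _),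
          lintegral_finsetSum _ fun k _ => (hq k).const_mul _, lintegral_const_mul _ hS,
          lintegral_const_mul _ h1]
        congr 2
        exact Finset.sum_congr rfl fun k _ => (lintegral_const_mul _ (hq k)).symm
    _ ≤ _ := by
        refine lintegral_mono fun y => ?_
        by_cases hy : y ∈ C <;> simp [hy, retTrunc]

lemma retTrunc_le_lintegral_hitTrunc (hC : MeasurableSet C) (N t : ℕ) (x : X) :
    retTrunc P C f (N + 1) t x ≤ ∫⁻ y, hitTrunc P C f N (t + 1) y ∂(P x) := by
  induction N generalizing t x with
  | zero =>
    refine (retTrunc_succ_le P hC 0 t x).trans (lintegral_mono fun y => ?_)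
    by_cases hy : y ∈ C <;> simp [hy, retTrunc, hitTrunc, survival, retTaboo]
  | succ N ih =>
    refine (retTrunc_succ_le P hC (N + 1) t x).trans (lintegral_mono fun y => ?_)
    by_cases hy : y ∈ C
    · simp [hy, hitTrunc_of_mem]
    · simpa [hy, hitTrunc_succ_of_notMem] using ih (t + 1) y

lemma le_hitTrunc (hf : Monotone f) (N t : ℕ) (x : X) : f t ≤ hitTrunc P C f N t x := by
  induction N generalizing t x with
  | zero => rfl
  | succ N ih =>
    by_cases hx : x ∈ C
    · rw [hitTrunc_of_mem P _ _ hx]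
    · rw [hitTrunc_succ_of_notMem P _ _ hx]
      calc f t ≤ f (t + 1) := hf t.le_succ
        _ = ∫⁻ _, f (t + 1) ∂(P x) := by simp
        _ ≤ _ := lintegral_mono fun y => ih (t + 1) y

/-- Waiting `m` steps before looking for `C` can only increase the truncated hitting time. -/
lemma hitTrunc_le_lintegral_kernelIter (hC : MeasurableSet C) (hf : Monotone f) (m N t : ℕ)
    (x : X) :
    hitTrunc P C f N t x ≤ ∫⁻ y, hitTrunc P C f (N - m) (t + m) y ∂(kernelIter P m x) := by
  have hbase (N m t : ℕ) (x : X) :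
      f t ≤ ∫⁻ y, hitTrunc P C f N (t + m) y ∂(kernelIter P m x) :=
    calc f t ≤ f (t + m) := hf (t.le_add_right m)
      _ = ∫⁻ _, f (t + m) ∂(kernelIter P m x) := by simp
      _ ≤ _ := lintegral_mono fun y => le_hitTrunc P hf N (t + m) y
  induction m generalizing N t x with
  | zero =>
    simp only [Nat.sub_zero, add_zero]
    rw [kernelIter, Kernel.id_apply, lintegral_dirac' _ (measurable_hitTrunc P hC N t)]
  | succ m ih =>
    by_cases hx : x ∈ C
    · rw [hitTrunc_of_mem P _ _ hx]
      exact hbase _ _ _ _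
    · cases N with
      | zero => exact hbase _ _ _ _
      | succ N =>
        rw [hitTrunc_succ_of_notMem P _ _ hx,
          lintegral_kernelIter_succ P m (measurable_hitTrunc P hC _ _)]
        refine lintegral_mono fun y => ?_
        have := ih N (t + 1) y
        rwa [show t + 1 + m = t + (m + 1) by ring, show N - m = N + 1 - (m + 1) by omega] at this

lemma lintegral_hitTrunc_le_lintegral_kernelIter (hC : MeasurableSet C) (hf : Monotone f)
    {m : ℕ} (hm : 1 ≤ m) (N t : ℕ) (x : X) :
    ∫⁻ y, hitTrunc P C f N (t + 1) y ∂(P x)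
      ≤ ∫⁻ y, hitTrunc P C f (N + 1 - m) (t + m) y ∂(kernelIter P m x) := by
  obtain ⟨m, rfl⟩ := Nat.exists_eq_add_of_le' hm
  rw [lintegral_kernelIter_succ P m (measurable_hitTrunc P hC _ _)]
  refine lintegral_mono fun y => ?_
  have := hitTrunc_le_lintegral_kernelIter P hC hf m N (t + 1) y
  rwa [show t + 1 + m = t + (m + 1) by ring, show N - m = N + 1 - (m + 1) by omega] at this

/-- If `H` dominates `f` and is a supersolution off `C` along the `n`-subsampled chain, then `H`
dominates the truncated hitting expectation. -/
lemma hitTrunc_le_of_supersolution (hC : MeasurableSet C) (hf : Monotone f) {n : X → ℕ}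
    (hn : ∀ x, 1 ≤ n x) {H : ℕ → X → ℝ≥0∞} (hfH : ∀ t x, f t ≤ H t x)
    (hH : ∀ t, ∀ x ∉ C, ∫⁻ y, H (t + n x) y ∂(kernelIter P (n x) x) ≤ H t x) (N t : ℕ) (x : X) :
    hitTrunc P C f N t x ≤ H t x := by
  induction N using Nat.strong_induction_on generalizing t x with
  | _ N ih =>
    by_cases hx : x ∈ C
    · rw [hitTrunc_of_mem P _ _ hx]
      exact hfH t x
    · cases N with
      | zero => exact hfH t x
      | succ N =>
        rw [hitTrunc_succ_of_notMem P _ _ hx]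
        have hlt : N + 1 - n x < N + 1 := by have := hn x; omega
        exact (lintegral_hitTrunc_le_lintegral_kernelIter P hC hf (hn x) N t x).trans
          ((lintegral_mono fun y => ih _ hlt _ y).trans (hH t x hx))

end Markov

lemma expReturn_le_of_retTrunc_le (P : Kernel X X) {C : Set X} {f : ℕ → ℝ≥0∞} (hf : Monotone f)
    {x : X} {B : ℝ≥0∞} (h : ∀ N, retTrunc P C f (N + 1) 0 x ≤ B) : expReturn P C f x ≤ B := by
  rw [expReturn, ENNReal.tsum_eq_iSup_nat' (tendsto_add_atTop_nat 1), ENNReal.iSup_mul,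
    ENNReal.iSup_add_iSup_of_monotone]
  · refine iSup_le fun N => le_trans ?_ (h N)
    simp only [retTrunc, zero_add]
    gcongr
    exact iInf_le _ _
  · intro i j hij
    exact Finset.sum_le_sum_of_subset (Finset.range_mono (by omega))
  · intro i j hij
    exact mul_le_mul_left (hf (by omega)) _

lemma expReturn_congr (P : Kernel X X) (C : Set X) {f g : ℕ → ℝ≥0∞}
    (h : ∀ k, f (k + 1) = g (k + 1)) (x : X) : expReturn P C f x = expReturn P C g x := by
  simp only [expReturn, h]

section Convex

/-- The increments of a concave function on `(0, ∞)` are antitone. -/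
lemma ConcaveOn.sub_shift_antitone {g : ℝ → ℝ} (hg : ConcaveOn ℝ (Ioi 0) g) {t : ℝ} (ht : 0 ≤ t)
    {u v : ℝ} (hu : 0 < u) (huv : u ≤ v) : g (t + v) - g v ≤ g (t + u) - g u := by
  rcases ht.eq_or_lt with rfl | ht
  · simp
  rcases huv.eq_or_lt with rfl | huv
  · exact le_rfl
  have hd : 0 < t + (v - u) := by linarith
  have hut : t + v ∈ Ioi (0 : ℝ) := by simp only [mem_Ioi]; linarith
  have hs : t / (t + (v - u)) + (v - u) / (t + (v - u)) = 1 := by field_simp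
  have ha : 0 ≤ t / (t + (v - u)) := by positivity
  have hb : 0 ≤ (v - u) / (t + (v - u)) := div_nonneg (by linarith) hd.le
  have e1 := hg.2 hu hut ha hb hs
  have e2 := hg.2 hu hut hb ha ((add_comm _ _).trans hs)
  simp only [smul_eq_mul] at e1 e2
  have p1 : t / (t + (v - u)) * u + (v - u) / (t + (v - u)) * (t + v) = v := by
    field_simp; ring
  have p2 : (v - u) / (t + (v - u)) * u + t / (t + (v - u)) * (t + v) = t + u := by
    field_simp; ring
  rw [p1] at e1
  rw [p2] at e2
  linear_combination e1 + e2 - (g u + g (t + v)) * hs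

variable {R R' : ℝ → ℝ}

lemma div_shift_antitone (hpos : ∀ t ∈ Ioi (0 : ℝ), 0 < R' t)
    (hlog : ConcaveOn ℝ (Ioi 0) (fun t => Real.log (R' t))) {t : ℝ} (ht : 0 ≤ t) {u v : ℝ}
    (hu : 0 < u) (huv : u ≤ v) :
    R' (t + v) / R' v ≤ R' (t + u) / R' u := by
  have hv : 0 < v := hu.trans_le huv
  have h1 := hpos (t + v) (add_pos_of_nonneg_of_pos ht hv)
  have h2 := hpos (t + u) (add_pos_of_nonneg_of_pos ht hu)
  rw [← Real.log_le_log_iff (div_pos h1 (hpos v hv)) (div_pos h2 (hpos u hu)),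
    Real.log_div h1.ne' (hpos v hv).ne', Real.log_div h2.ne' (hpos u hu).ne']
  exact hlog.sub_shift_antitone ht hu huv

/-- The map `R s ↦ R (t + s)` lies below its tangent lines. -/
lemma shift_le_tangent (hd : ∀ t ∈ Ioi (0 : ℝ), HasDerivAt R (R' t) t)
    (hpos : ∀ t ∈ Ioi (0 : ℝ), 0 < R' t)
    (hlog : ConcaveOn ℝ (Ioi 0) (fun t => Real.log (R' t)))
    {t : ℝ} (ht : 0 ≤ t) {s₀ s : ℝ} (hs₀ : 0 < s₀) (hs : 0 < s) :
    R (t + s) ≤ R (t + s₀) + R' (t + s₀) / R' s₀ * (R s - R s₀) := by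
  set c := R' (t + s₀) / R' s₀
  have hder (u : ℝ) (hu : 0 < u) :
      HasDerivAt (fun s => R (t + s) - c * R s) (R' (t + u) - c * R' u) u :=
    ((hd (t + u) (add_pos_of_nonneg_of_pos ht hu)).comp_const_add t u).sub
      ((hd u hu).const_mul c)
  have key : R (t + s) - c * R s ≤ R (t + s₀) - c * R s₀ := by
    rcases le_total s₀ s with h | h
    · refine antitoneOn_of_deriv_nonpos (convex_Icc s₀ s)
        (f := fun s => R (t + s) - c * R s)
        (fun u hu => (hder u (hs₀.trans_le hu.1)).continuousAt.continuousWithinAt)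
        (fun u hu => ?_) (fun u hu => ?_) (left_mem_Icc.2 h) (right_mem_Icc.2 h) h
      · rw [interior_Icc] at hu
        exact (hder u (hs₀.trans hu.1)).differentiableAt.differentiableWithinAt
      · rw [interior_Icc] at hu
        have hu0 := hs₀.trans hu.1
        rw [(hder u hu0).deriv, sub_nonpos, ← div_le_iff₀ (hpos u hu0)]
        exact div_shift_antitone hpos hlog ht hs₀ hu.1.le
    · refine monotoneOn_of_deriv_nonneg (convex_Icc s s₀)
        (f := fun s => R (t + s) - c * R s)
        (fun u hu => (hder u (hs.trans_le hu.1)).continuousAt.continuousWithinAt)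
        (fun u hu => ?_) (fun u hu => ?_) (left_mem_Icc.2 h) (right_mem_Icc.2 h) h
      · rw [interior_Icc] at hu
        exact (hder u (hs.trans hu.1)).differentiableAt.differentiableWithinAt
      · rw [interior_Icc] at hu
        have hu0 := hs.trans hu.1
        rw [(hder u hu0).deriv, sub_nonneg, ← le_div_iff₀ (hpos u hu0)]
        exact div_shift_antitone hpos hlog ht hu0 hu.2.le
  linear_combination key

/-- The map `R s ↦ R (t + s)` is dominated by an affine function with nonnegative coefficients,
with equality at `s₀`. -/
lemma exists_affine_majorant (hd : ∀ t ∈ Ioi (0 : ℝ), HasDerivAt R (R' t) t)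
    (hpos : ∀ t ∈ Ioi (0 : ℝ), 0 < R' t)
    (hlog : ConcaveOn ℝ (Ioi 0) (fun t => Real.log (R' t)))
    (hR : BijOn R (Ioi 0) (Ioi 0)) {t : ℝ} (ht : 0 ≤ t) {s₀ : ℝ}
    (hs₀ : 0 < s₀) :
    ∃ a c : ℝ, 0 ≤ a ∧ 0 ≤ c ∧ a + c * R s₀ = R (t + s₀) ∧
      ∀ s, 0 < s → R (t + s) ≤ a + c * R s := by
  have hc : 0 < R' (t + s₀) / R' s₀ :=
    div_pos (hpos _ (add_pos_of_nonneg_of_pos ht hs₀)) (hpos _ hs₀)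
  have htan (s : ℝ) (hs : 0 < s) := shift_le_tangent hd hpos hlog ht hs₀ hs
  set c := R' (t + s₀) / R' s₀
  refine ⟨R (t + s₀) - c * R s₀, c, ?_, hc.le, by ring, fun s hs => ?_⟩
  · refine le_of_forall_pos_le_add fun ε hε => ?_
    obtain ⟨s, hs, hsε⟩ := hR.surjOn (show ε / c ∈ Ioi (0 : ℝ) from div_pos hε hc)
    have h1 : 0 < R (t + s) := hR.mapsTo (add_pos_of_nonneg_of_pos ht hs)
    have h2 := htan s hs
    have h3 : c * R s = ε := by rw [hsε]; field_simp
    linear_combination h1.le + h2 + h3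
  · linear_combination htan s hs

end Convex

/-- Theorem `subsampled2moments`, case (ii).  From the state-dependent drift
condition `P^{n(x)} W (x) ≤ β W(x) + b 1_C(x)` and a strictly increasing, convex, continuously
differentiable bijection `R` of `(0,∞)` with log-concave derivative `R'` satisfying
`R⁻¹(W) - R⁻¹(β W) ≥ n`, one gets `𝔼ₓ[R(τ_C)] ≤ C' (W(x) + b 1_C(x))`. -/
theorem statement8
    (P : Kernel X X) [IsMarkovKernel P]
    (W : X → ℝ) (hWmeas : Measurable W) (hW1 : ∀ x, 1 ≤ W x)
    (n : X → ℕ) (hnmeas : Measurable n) (hn1 : ∀ x, 1 ≤ n x)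
    (β : ℝ) (hβ : β ∈ Set.Ioo (0 : ℝ) 1) (b : ℝ) (hb : 0 ≤ b)
    (C : Set X) (hCmeas : MeasurableSet C)
    (hdrift : ∀ x, kernelExp ((kernelIter P (n x)) x) W
        ≤ ENNReal.ofReal (β * W x + b * Set.indicator C (fun _ => 1) x))
    (R : ℝ → ℝ) (hRmono : StrictMonoOn R (Set.Ioi 0))
    (hRbij : Set.BijOn R (Set.Ioi 0) (Set.Ioi 0))
    (hRconv : ConvexOn ℝ (Set.Ioi 0) R)
    (R' : ℝ → ℝ) (hR'cont : ContinuousOn R' (Set.Ioi 0))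
    (hR'deriv : ∀ t ∈ Set.Ioi (0 : ℝ), HasDerivAt R (R' t) t)
    (hR'pos : ∀ t ∈ Set.Ioi (0 : ℝ), 0 < R' t)
    (hR'logconc : ConcaveOn ℝ (Set.Ioi 0) (fun t => Real.log (R' t)))
    (Rinv : ℝ → ℝ)
    (hRinv : ∀ t ∈ Set.Ioi (0 : ℝ), Rinv (R t) = t ∧ R (Rinv t) = t ∧ Rinv t ∈ Set.Ioi (0 : ℝ))
    (hRn : ∀ x, (n x : ℝ) ≤ Rinv (W x) - Rinv (β * W x)) :
    ∃ C' : ℝ, 0 ≤ C' ∧ ∀ x,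
      expReturn P C (fun k : ℕ => ENNReal.ofReal (R k)) x
        ≤ ENNReal.ofReal (C' * (W x + b * Set.indicator C (fun _ => 1) x)) := by
  have hβ0 : 0 < β := hβ.1
  have hW0 (x : X) : 0 < W x := zero_lt_one.trans_le (hW1 x)
  set δ : X → ℝ := fun x => b * Set.indicator C (fun _ => 1) x with hδ
  have hδ0 (x : X) : 0 ≤ δ x := mul_nonneg hb (indicator_nonneg (fun _ _ => zero_le_one) x)
  have hs0 (x : X) : 0 < Rinv (W x) := (hRinv _ (hW0 x)).2.2
  let H : ℕ → X → ℝ≥0∞ := fun t x => ENNReal.ofReal (R (t + Rinv (W x)))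
  let f : ℕ → ℝ≥0∞ := fun k => if k = 0 then 0 else ENNReal.ofReal (R k)
  have hf : Monotone f := by
    intro i j hij
    rcases Nat.eq_zero_or_pos i with rfl | hi
    · simp [f]
    · have hi' : (0 : ℝ) < i := by exact_mod_cast hi
      have hij' : (i : ℝ) ≤ j := by exact_mod_cast hij
      simp only [f, hi.ne', (hi.trans_le hij).ne', if_false]
      exact ENNReal.ofReal_le_ofReal (hRmono.monotoneOn hi' (hi'.trans_le hij') hij')
  have hfH (t : ℕ) (x : X) : f t ≤ H t x := by
    rcases Nat.eq_zero_or_pos t with rfl | ht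
    · simp [f]
    · have ht' : (0 : ℝ) < t := by exact_mod_cast ht
      simp only [f, H, ht.ne', if_false]
      exact ENNReal.ofReal_le_ofReal (hRmono.monotoneOn ht' (add_pos ht' (hs0 x))
        (le_add_of_nonneg_right (hs0 x).le))
  have hstep (t : ℕ) (x : X) : ∫⁻ y, H (t + n x) y ∂(kernelIter P (n x) x)
      ≤ ENNReal.ofReal ((1 + δ x / (β * W x)) * R (t + Rinv (W x))) := by
    have hβW : 0 < β * W x := mul_pos hβ0 (hW0 x)
    obtain ⟨-, hRs, hs⟩ := hRinv _ hβW
    obtain ⟨a, c, ha, hc, hac, hmaj⟩ := exists_affine_majorant hR'deriv hR'pos hR'logconc hRbij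
      (t := ((t + n x : ℕ) : ℝ)) (Nat.cast_nonneg _) hs
    rw [hRs] at hac
    calc ∫⁻ y, H (t + n x) y ∂(kernelIter P (n x) x)
        ≤ ∫⁻ y, ENNReal.ofReal a + ENNReal.ofReal c * ENNReal.ofReal (W y)
            ∂(kernelIter P (n x) x) := by
          refine lintegral_mono fun y => ?_
          rw [← ENNReal.ofReal_mul hc, ← ENNReal.ofReal_add ha (mul_nonneg hc (hW0 y).le)]
          refine ENNReal.ofReal_le_ofReal ?_
          have := hmaj _ (hs0 y)
          rwa [(hRinv _ (hW0 y)).2.1] at this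
      _ = ENNReal.ofReal a + ENNReal.ofReal c * kernelExp (kernelIter P (n x) x) W := by
          rw [lintegral_add_left measurable_const,
            lintegral_const_mul _ hWmeas.ennreal_ofReal]
          simp [kernelExp]
      _ ≤ ENNReal.ofReal a + ENNReal.ofReal c * ENNReal.ofReal (β * W x + δ x) := by
          gcongr
          exact hdrift x
      _ = ENNReal.ofReal (a + c * (β * W x + δ x)) := by
          rw [← ENNReal.ofReal_mul hc,
            ← ENNReal.ofReal_add ha (mul_nonneg hc (add_nonneg hβW.le (hδ0 x)))]
      _ ≤ _ := by
          refine ENNReal.ofReal_le_ofReal ?_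
          have hq : 0 ≤ δ x / (β * W x) := div_nonneg (hδ0 x) hβW.le
          have hqe : δ x / (β * W x) * (β * W x) = δ x :=
            div_mul_cancel₀ _ hβW.ne'
          have hle : R (((t + n x : ℕ) : ℝ) + Rinv (β * W x)) ≤ R (t + Rinv (W x)) := by
            refine hRmono.monotoneOn (mem_Ioi.2 (add_pos_of_nonneg_of_pos (Nat.cast_nonneg _) hs))
              (mem_Ioi.2 (add_pos_of_nonneg_of_pos (Nat.cast_nonneg _) (hs0 x))) ?_
            push_cast
            linarith [hRn x]
          calc a + c * (β * W x + δ x)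
              ≤ (1 + δ x / (β * W x)) * (a + c * (β * W x)) := by
                linear_combination mul_nonneg hq ha - c * hqe
            _ ≤ _ := by
                rw [hac]
                gcongr
  refine ⟨1 / β, by positivity, fun x => ?_⟩
  rw [expReturn_congr P C (g := f) (fun k => by simp [f])]
  refine expReturn_le_of_retTrunc_le P hf fun N => ?_
  refine (retTrunc_le_lintegral_hitTrunc P hCmeas N 0 x).trans ?_
  refine (lintegral_hitTrunc_le_lintegral_kernelIter P hCmeas hf (hn1 x) N 0 x).trans ?_
  refine (lintegral_mono fun y => hitTrunc_le_of_supersolution P hCmeas hf hn1 hfH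
    (fun t x hx => (hstep t x).trans_eq ?_) _ _ y).trans ((hstep 0 x).trans ?_)
  · simp [hδ, hx, H]
  · refine ENNReal.ofReal_le_ofReal ?_
    rw [Nat.cast_zero, zero_add, (hRinv _ (hW0 x)).2.1]
    have h1 : (1 + δ x / (β * W x)) * W x = W x + 1 / β * δ x := by
      have := (hW0 x).ne'
      field_simp
    have h2 : W x ≤ 1 / β * W x :=
      le_mul_of_one_le_left (hW0 x).le ((one_le_div hβ0).2 hβ.2.le)
    linear_combination h1 + h2
end
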